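/- arXiv:1201.4267 — 2 statements merged into one kernel-verified Lean document; each statement's English description precedes it below -/
import Mathlib

section
/- Let k be an algebraically closed field of characteristic zero and let A, B be finite-dimensional k-algebras. Then the Jacobson radical of the tensor product algebra A ⊗_k B equals J(A) ⊗_k B + A ⊗_k J(B), i.e. it is the subspace of A ⊗_k B spanned by the images of J(A) ⊗_k B and A ⊗_k J(B) under the canonical inclusions. -/
open TensorProduct

universe u v

theorem isSemisimpleRing_tensor_aux
    (k : Type*) [Field k] [IsAlgClosed k]
    (S : Type*) [Ring S] [Algebra k S] [IsSemisimpleRing S]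
    (T : Type*) [Ring T] [Algebra k T] [FiniteDimensional k T] [IsSemisimpleRing T] :
    IsSemisimpleRing (S ⊗[k] T) := by
  obtain ⟨n, d, -, ⟨e⟩⟩ := IsSemisimpleRing.exists_algEquiv_pi_matrix_of_isAlgClosed k T
  have e1 : S ⊗[k] T ≃ₐ[k] S ⊗[k] (Π i, Matrix (Fin (d i)) (Fin (d i)) k) :=
    Algebra.TensorProduct.congr AlgEquiv.refl e
  have e2 := Algebra.TensorProduct.piRight k k S (fun i => Matrix (Fin (d i)) (Fin (d i)) k)
  have e3 : (Π i, S ⊗[k] Matrix (Fin (d i)) (Fin (d i)) k) ≃ₐ[k]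
      Π i, Matrix (Fin (d i)) (Fin (d i)) S :=
    AlgEquiv.piCongrRight fun i => (matrixEquivTensor (Fin (d i)) k S).symm
  exact ((e1.trans e2).trans e3).symm.toRingEquiv.isSemisimpleRing

/-- Span of `a ⊗ b` with `a ∈ I`. -/
def leftSpanAux (k : Type*) [Field k] {A : Type*} [Ring A] [Algebra k A]
    (B : Type*) [Ring B] [Algebra k B] (I : Ideal A) : Submodule k (A ⊗[k] B) :=
  Submodule.span k {z | ∃ a ∈ I, ∃ b : B, z = a ⊗ₜ[k] b}

theorem leftSpanAux_mul (k : Type*) [Field k] {A : Type*} [Ring A] [Algebra k A]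
    (B : Type*) [Ring B] [Algebra k B] (I I' : Ideal A) {x y : A ⊗[k] B}
    (hx : x ∈ leftSpanAux k B I) (hy : y ∈ leftSpanAux k B I') :
    x * y ∈ leftSpanAux k B (I * I') := by
  have h := Submodule.mul_mem_mul hx hy
  rw [leftSpanAux, leftSpanAux, Submodule.span_mul_span] at h
  refine Submodule.span_mono ?_ h
  rintro _ ⟨_, ⟨a, ha, b, rfl⟩, _, ⟨a', ha', b', rfl⟩, rfl⟩
  exact ⟨a * a', Ideal.mul_mem_mul ha ha', b * b', by simp⟩

theorem leftSpanAux_top_mul (k : Type*) [Field k] {A : Type*} [Ring A] [Algebra k A]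
    (B : Type*) [Ring B] [Algebra k B] (I : Ideal A) (x : A ⊗[k] B) {y : A ⊗[k] B}
    (hy : y ∈ leftSpanAux k B I) :
    x * y ∈ leftSpanAux k B I := by
  have hx : x ∈ leftSpanAux k B (⊤ : Ideal A) := by
    induction x with
    | zero => exact zero_mem _
    | tmul a b => exact Submodule.subset_span ⟨a, trivial, b, rfl⟩
    | add x y hx hy => exact add_mem hx hy
  have h := leftSpanAux_mul k B _ _ hx hy
  refine Submodule.span_mono ?_ h
  rintro _ ⟨a, ha, b, rfl⟩
  exact ⟨a, Ideal.mul_le_right ha, b, rfl⟩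

theorem leftSpanAux_pow (k : Type*) [Field k] {A : Type*} [Ring A] [Algebra k A]
    (B : Type*) [Ring B] [Algebra k B] (I : Ideal A) {x : A ⊗[k] B}
    (hx : x ∈ leftSpanAux k B I) (n : ℕ) :
    x ^ n ∈ leftSpanAux k B (I ^ n) := by
  induction n with
  | zero =>
    rw [pow_zero, Submodule.pow_zero]
    exact Submodule.subset_span ⟨1, by simp, 1, rfl⟩
  | succ n ih =>
    rw [pow_succ, Submodule.pow_succ]
    exact leftSpanAux_mul k B _ _ ih hx

theorem tmul_mem_jacobson_aux (k : Type*) [Field k] {A : Type*} [Ring A] [Algebra k A]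
    {B : Type*} [Ring B] [Algebra k B] (I : Ideal A) (hI : IsNilpotent I) {a : A}
    (ha : a ∈ I) (b : B) : a ⊗ₜ[k] b ∈ Ring.jacobson (A ⊗[k] B) := by
  rw [← Ideal.jacobson_bot, Ideal.mem_jacobson_iff]
  intro y
  have hx : a ⊗ₜ[k] b ∈ leftSpanAux k B I := Submodule.subset_span ⟨a, ha, b, rfl⟩
  have hyx := leftSpanAux_top_mul k B I y hx
  have hnil : IsNilpotent (y * a ⊗ₜ[k] b) := by
    obtain ⟨n, hn⟩ := hI
    refine ⟨n, ?_⟩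
    have h := leftSpanAux_pow k B I hyx n
    rw [hn] at h
    have h0 : leftSpanAux k B (0 : Ideal A) ≤ ⊥ := by
      refine Submodule.span_le.mpr ?_
      rintro _ ⟨a, ha, b, rfl⟩
      have : a = 0 := by simpa using ha
      simp [this]
    simpa using h0 h
  obtain ⟨u, hu⟩ := hnil.isUnit_add_one
  refine ⟨(↑u⁻¹ : A ⊗[k] B), ?_⟩
  have : (↑u⁻¹ : A ⊗[k] B) * (y * a ⊗ₜ[k] b + 1) = 1 := by rw [← hu]; simp
  rw [mul_add, mul_one, ← mul_assoc] at this
  rw [this]; simp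

/-- Let `k` be an algebraically closed field of characteristic zero and let
`A`, `B` be finite-dimensional `k`-algebras.  Then the Jacobson radical of `A ⊗[k] B` equals
`J(A) ⊗ B + A ⊗ J(B)`, i.e. it is the subspace of `A ⊗[k] B` spanned by the images of
`J(A) ⊗[k] B` and `A ⊗[k] J(B)` under the canonical inclusions. -/
theorem jacobson_radical_tensorProduct
    (k : Type u) [Field k] [IsAlgClosed k] [CharZero k]
    (A : Type v) [Ring A] [Algebra k A] [FiniteDimensional k A]
    (B : Type v) [Ring B] [Algebra k B] [FiniteDimensional k B] :
    Submodule.restrictScalars k ((⊥ : Ideal (A ⊗[k] B)).jacobson)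
      = LinearMap.range (TensorProduct.map
            (Submodule.restrictScalars k ((⊥ : Ideal A).jacobson)).subtype
            (LinearMap.id : B →ₗ[k] B))
        ⊔ LinearMap.range (TensorProduct.map
            (LinearMap.id : A →ₗ[k] A)
            (Submodule.restrictScalars k ((⊥ : Ideal B).jacobson)).subtype) := by
  have : IsArtinianRing A := IsArtinianRing.of_finite k A
  have : IsArtinianRing B := IsArtinianRing.of_finite k B
  rw [Ideal.jacobson_bot, Ideal.jacobson_bot, Ideal.jacobson_bot]
  apply le_antisymm
  · let f := Ideal.Quotient.mkₐ k (Ring.jacobson A)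
    let g := Ideal.Quotient.mkₐ k (Ring.jacobson B)
    have hf : Function.Surjective f := Ideal.Quotient.mkₐ_surjective k _
    have hg : Function.Surjective g := Ideal.Quotient.mkₐ_surjective k _
    have : FiniteDimensional k (B ⧸ Ring.jacobson B) :=
      Module.Finite.of_surjective g.toLinearMap hg
    have hss := isSemisimpleRing_tensor_aux k (A ⧸ Ring.jacobson A) (B ⧸ Ring.jacobson B)
    have ef : Function.Exact
        (Submodule.restrictScalars k (Ring.jacobson A)).subtype f.toLinearMap := by
      intro x
      simp [f, Ideal.Quotient.eq_zero_iff_mem]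
    have eg : Function.Exact
        (Submodule.restrictScalars k (Ring.jacobson B)).subtype g.toLinearMap := by
      intro x
      simp [g, Ideal.Quotient.eq_zero_iff_mem]
    have hker := TensorProduct.map_ker ef hf eg hg
    rw [sup_comm]
    refine le_trans ?_ hker.le
    intro x hx
    let F := (Algebra.TensorProduct.map f g : A ⊗[k] B →ₐ[k] _)
    have hF : Function.Surjective F := Algebra.TensorProduct.map_surjective f g hf hg
    have : RingHomSurjective F.toRingHom := ⟨hF⟩
    have h := Ring.le_comap_jacobson F.toRingHom hx
    rw [IsSemisimpleRing.jacobson_eq_bot ((A ⧸ Ring.jacobson A) ⊗[k] (B ⧸ Ring.jacobson B))] at h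
    exact h
  · rw [sup_le_iff]
    constructor
    · rintro _ ⟨x, rfl⟩
      induction x with
      | zero => rw [map_zero]; exact zero_mem _
      | tmul a b =>
        exact tmul_mem_jacobson_aux k (Ring.jacobson A) IsSemiprimaryRing.isNilpotent a.2 b
      | add x y hx hy => rw [map_add]; exact add_mem hx hy
    · rintro _ ⟨x, rfl⟩
      induction x with
      | zero => rw [map_zero]; exact zero_mem _
      | tmul a b =>
        have h := tmul_mem_jacobson_aux k (Ring.jacobson B) IsSemiprimaryRing.isNilpotent b.2 a
        let F := (Algebra.TensorProduct.comm k B A).toAlgHom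
        have : RingHomSurjective F.toRingHom := ⟨(Algebra.TensorProduct.comm k B A).surjective⟩
        exact Ring.le_comap_jacobson F.toRingHom h
      | add x y hx hy => rw [map_add]; exact add_mem hx hy
end

section
/- Let k be an algebraically closed field of characteristic zero and A a finite-dimensional k-algebra. Let (S_i)_{i∈I} be a complete set of representatives of the isomorphism classes of simple left A-modules with projective covers (P_i)_{i∈I}. Regard A as a left module over A ⊗_k A^op via (a⊗b)·x = a x b. Then for all i, j ∈ I, the composition multiplicity of the simple A ⊗_k A^op-module S_i ⊗_k (S_j)^* in A equals the Cartan matrix entry c_{ij} = dim_k Hom_A(P_i, P_j), where (S_j)^* = Hom_k(S_j, k) is the dual right A-module (a left A^op-module) with action (f·a)(s) = f(a·s). -/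
open TensorProduct

/-- The number of composition factors of a composition series `cs` that are
isomorphic to the module `S`, i.e. the composition multiplicity `[M : S]`. -/
noncomputable def compMult {A : Type*} [Ring A] {M : Type*} [AddCommGroup M] [Module A M]
    (cs : CompositionSeries (Submodule A M))
    (S : Type*) [AddCommGroup S] [Module A S] : ℕ :=
  Nat.card {i : Fin cs.length //
    Nonempty ((↥(cs i.succ) ⧸ Submodule.comap (cs i.succ).subtype (cs i.castSucc)) ≃ₗ[A] S)}

universe u v

set_option linter.unusedSectionVars false

namespace BimodCartan

/-- Abstract data: an idempotent `e` belonging to the simple module `S`. -/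
structure PrimData (k : Type u) [Field k] (A : Type v) [Ring A] [Algebra k A]
    (S : Type v) [AddCommGroup S] [Module k S] [Module A S] (e : A) (s : S)
    (l : Module.Dual k S) : Prop where
  idem : e * e = e
  es : e • s = s
  ls : l s = 1
  ey : ∀ y : S, e • y = l y • s
  only : ∀ (U : Type v) [AddCommGroup U] [Module A U], IsSimpleModule A U →
    ∀ u : U, e • u ≠ 0 → Nonempty (U ≃ₗ[A] S)

section data

variable {k : Type u} [Field k] {A : Type v} [Ring A] [Algebra k A]

lemma ker_eq {S P U : Type v} [AddCommGroup S] [Module A S] [AddCommGroup P] [Module A P]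
    [AddCommGroup U] [Module A U] (hS : IsSimpleModule A S) (hU : IsSimpleModule A U)
    (f : P →ₗ[A] S) (hf : Function.Surjective f)
    (hsmall : ∀ K : Submodule A P, LinearMap.ker f ⊔ K = ⊤ → K = ⊤)
    (φ : P →ₗ[A] U) (hφ : φ ≠ 0) : LinearMap.ker φ = LinearMap.ker f := by
  have h1 : IsCoatom (LinearMap.ker f) := LinearMap.isCoatom_ker_of_surjective hf
  have h2 : IsCoatom (LinearMap.ker φ) :=
    LinearMap.isCoatom_ker_of_surjective (LinearMap.surjective_of_ne_zero hφ)
  by_contra hne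
  have h3 : LinearMap.ker f ⊔ LinearMap.ker φ = ⊤ := h1.sup_eq_top_of_ne h2 (Ne.symm hne)
  exact h2.1 (hsmall _ h3)

lemma exists_data [IsAlgClosed k] (S P : Type v)
    [AddCommGroup S] [Module k S] [Module A S] [IsScalarTower k A S] [FiniteDimensional k S]
    [AddCommGroup P] [Module A P] (hS : IsSimpleModule A S) (hP : Module.Projective A P)
    (f : P →ₗ[A] S) (hf : Function.Surjective f)
    (hsmall : ∀ K : Submodule A P, LinearMap.ker f ⊔ K = ⊤ → K = ⊤) :
    ∃ (p : P) (σ : P →ₗ[A] A) (s : S) (l : Module.Dual k S),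
      (∀ x, σ x • p = x) ∧ PrimData k A S (σ p) s l := by
  have := hS
  have := IsSimpleModule.nontrivial A S
  obtain ⟨s, hs⟩ := exists_ne (0 : S)
  obtain ⟨p, rfl⟩ := hf s
  have htop : Submodule.span A {p} = ⊤ := by
    apply hsmall
    rw [eq_top_iff]
    intro x _
    obtain ⟨a, ha⟩ := IsSimpleModule.toSpanSingleton_surjective A hs (f x)
    simp only [LinearMap.toSpanSingleton_apply] at ha
    rw [Submodule.mem_sup]
    refine ⟨x - a • p, ?_, a • p, Submodule.smul_mem _ _ (Submodule.mem_span_singleton_self p),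
      by abel⟩
    simp [ha]
  have hsp : LinearMap.range (LinearMap.toSpanSingleton A P p) = ⊤ := by
    rw [← htop, LinearMap.span_singleton_eq_range]
  obtain ⟨σ, hσ⟩ := LinearMap.exists_rightInverse_of_surjective _ hsp
  have hσ' : ∀ x, σ x • p = x := fun x => by simpa using LinearMap.congr_fun hσ x
  have hes : σ p • f p = f p := by rw [← map_smul, hσ']
  have hex : ∀ y : S, ∃ c : k, σ p • y = c • f p := by
    intro y
    let φ : P →ₗ[A] S := (LinearMap.toSpanSingleton A S y).comp σ
    by_cases h0 : φ = 0
    · refine ⟨0, ?_⟩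
      have := LinearMap.congr_fun h0 p
      simpa [φ] using this
    · have hk := ker_eq hS hS f hf hsmall φ h0
      let g : S →ₗ[A] S := ((LinearMap.ker f).liftQ φ hk.ge).comp
        (f.quotKerEquivOfSurjective hf).symm.toLinearMap
      have hg : ∀ x, g (f x) = φ x := by
        intro x
        have : (f.quotKerEquivOfSurjective hf).symm (f x) = (LinearMap.ker f).mkQ x := by
          rw [LinearEquiv.symm_apply_eq]; rfl
        simp [g, this]
      obtain ⟨c, hc⟩ := (IsSimpleModule.algebraMap_end_bijective_of_isAlgClosed k
        (A := A) (V := S)).2 g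
      refine ⟨c, ?_⟩
      have h1 := hg p
      rw [← hc] at h1
      simpa [φ, Module.algebraMap_end_apply] using h1.symm
  obtain ⟨l0, hl0⟩ := Module.Projective.exists_dual_ne_zero k hs
  refine ⟨p, σ, f p, (l0 (f p))⁻¹ • (l0.comp (Algebra.lsmul k k S (σ p))), hσ', ?_, hes, ?_, ?_, ?_⟩
  · rw [← smul_eq_mul, ← map_smul, hσ']
  · simp [hes, hl0]
  · intro y
    obtain ⟨c, hc⟩ := hex y
    simp [hc, hl0, mul_comm c]
  · intro U _ _ hU u hu
    let φ : P →ₗ[A] U := (LinearMap.toSpanSingleton A U u).comp σ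
    have h0 : φ ≠ 0 := by
      intro h
      apply hu
      simpa [φ] using LinearMap.congr_fun h p
    have hk := ker_eq hS hU f hf hsmall φ h0
    exact ⟨((φ.quotKerEquivOfSurjective (LinearMap.surjective_of_ne_zero h0)).symm.trans
      (Submodule.quotEquivOfEq _ _ hk)).trans (f.quotKerEquivOfSurjective hf)⟩

lemma PrimData.sub_mem {S : Type v} [AddCommGroup S] [Module k S] [Module A S]
    [IsScalarTower k A S]
    {e : A} {s : S} {l : Module.Dual k S} (h : PrimData k A S e s l) (a : A) :
    e * a * e - l (a • s) • e ∈ Ring.jacobson A := by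
  have key : ∀ (U : Type v) [AddCommGroup U] [Module A U], IsSimpleModule A U → ∀ u : U,
      (e * a * e - l (a • s) • e) • u = 0 := by
    intro U _ _ hU u
    by_cases hu : e • u = 0
    · rw [show e * a * e - l (a • s) • e = (e * a - algebraMap k A (l (a • s))) * e by
        rw [sub_mul, Algebra.smul_def], mul_smul, hu, smul_zero]
    · obtain ⟨g⟩ := h.only U hU u hu
      apply g.injective
      rw [map_smul, map_zero]
      generalize g u = y
      have : SMulCommClass A k S := inferInstance
      rw [sub_smul, mul_smul, mul_smul, smul_assoc, h.ey y, smul_comm a, smul_comm e, h.ey,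
        smul_comm, sub_self]
  rw [Ring.jacobson_eq_sInf_isMaximal, Submodule.mem_sInf]
  intro m hm
  have hm' : IsSimpleModule A (A ⧸ m) := isSimpleModule_iff_isCoatom.2 (Ideal.isMaximal_def.1 hm)
  have := key _ hm' (Submodule.Quotient.mk 1)
  rwa [← Submodule.Quotient.mk_smul, smul_eq_mul, mul_one, Submodule.Quotient.mk_eq_zero] at this

lemma nilp_of_mem [FiniteDimensional k A] {n : A} (hn : n ∈ Ring.jacobson A) : IsNilpotent n := by
  have : IsArtinianRing A := IsArtinianRing.of_finite k A
  obtain ⟨m, hm⟩ := IsSemiprimaryRing.isNilpotent (R := A)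
  refine ⟨m, ?_⟩
  have := Ideal.pow_mem_pow hn m
  rwa [hm] at this

end data

section iso

variable {k : Type u} [Field k] {E : Type*} [Ring E]

lemma ker_le_of_scalar {Q T : Type*} [AddCommGroup Q] [Module E Q] [Module k Q]
    [AddCommGroup T] [Module E T] [Module k T] [IsSimpleModule E Q]
    (ε : E) (t : T) (v : Q) (ht : t ≠ 0) (hεv : ε • v = v)
    (hC : ∀ x : E, ∃ c : k, (ε * x) • t = c • t ∧ (ε * x) • v = c • v) (x : E)
    (hx : x • t = 0) : x • v = 0 := by
  by_contra hne
  obtain ⟨y, hy⟩ := IsSimpleModule.toSpanSingleton_surjective E hne v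
  simp only [LinearMap.toSpanSingleton_apply] at hy
  obtain ⟨c, h1, h2⟩ := hC (y * x)
  rw [mul_smul, mul_smul, hx, smul_zero, smul_zero] at h1
  rw [mul_smul, mul_smul, hy, hεv] at h2
  rcases smul_eq_zero.1 h1.symm with h | h
  · rw [h, zero_smul] at h2
    rw [h2, smul_zero] at hne
    exact hne rfl
  · exact ht h

lemma iso_of_scalar {Q T : Type*} [AddCommGroup Q] [Module E Q] [Module k Q]
    [AddCommGroup T] [Module E T] [Module k T] [IsSimpleModule E Q] [IsSimpleModule E T]
    (ε : E) (t : T) (v : Q) (ht : t ≠ 0) (hv : v ≠ 0) (hεt : ε • t = t) (hεv : ε • v = v)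
    (hC : ∀ x : E, ∃ c : k, (ε * x) • t = c • t ∧ (ε * x) • v = c • v) :
    Nonempty (Q ≃ₗ[E] T) := by
  have hk : LinearMap.ker (LinearMap.toSpanSingleton E Q v) =
      LinearMap.ker (LinearMap.toSpanSingleton E T t) := by
    ext x
    simp only [LinearMap.mem_ker, LinearMap.toSpanSingleton_apply]
    exact ⟨ker_le_of_scalar (k := k) ε v t hv hεt (fun x => (hC x).imp fun _ h => h.symm) x,
      ker_le_of_scalar (k := k) ε t v ht hεv hC x⟩
  exact ⟨((LinearMap.quotKerEquivOfSurjective _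
    (IsSimpleModule.toSpanSingleton_surjective E hv)).symm.trans
    (Submodule.quotEquivOfEq _ _ hk)).trans
    (LinearMap.quotKerEquivOfSurjective _ (IsSimpleModule.toSpanSingleton_surjective E ht))⟩

end iso

section bimod

variable {k : Type u} [Field k] {A : Type v} [Ring A] [Algebra k A] [FiniteDimensional k A]
  {Q : Type*} [AddCommGroup Q] [Module (A ⊗[k] Aᵐᵒᵖ) Q] [Module k Q]
  [IsScalarTower k (A ⊗[k] Aᵐᵒᵖ) Q] [FiniteDimensional k Q]

/-- left multiplication element -/
abbrev lft (k : Type u) [Field k] {A : Type v} [Ring A] [Algebra k A] (a : A) : A ⊗[k] Aᵐᵒᵖ :=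
  a ⊗ₜ[k] (1 : Aᵐᵒᵖ)

/-- right multiplication element -/
abbrev rgt (k : Type u) [Field k] {A : Type v} [Ring A] [Algebra k A] (a : A) : A ⊗[k] Aᵐᵒᵖ :=
  (1 : A) ⊗ₜ[k] (MulOpposite.op a)

lemma jac_left [IsSimpleModule (A ⊗[k] Aᵐᵒᵖ) Q] {n : A} (hn : n ∈ Ring.jacobson A) (q : Q) :
    lft k n • q = 0 := by
  let N : Submodule (A ⊗[k] Aᵐᵒᵖ) Q :=
    { carrier := {q | ∀ n ∈ Ring.jacobson A, lft k n • q = 0}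
      add_mem' := fun {x y} hx hy n hn => by rw [smul_add, hx n hn, hy n hn, add_zero]
      zero_mem' := fun n _ => smul_zero _
      smul_mem' := by
        intro x q hq n hn
        induction x with
        | zero => exact (congrArg (lft k n • ·) (zero_smul (A ⊗[k] Aᵐᵒᵖ) q)).trans (smul_zero _)
        | add x y hx hy => rw [add_smul, smul_add, hx, hy, add_zero]
        | tmul a b =>
          have h1 := hq (n * a) (Ideal.mul_mem_right _ _ hn)
          rw [← mul_smul, Algebra.TensorProduct.tmul_mul_tmul, one_mul,
            show (n * a) ⊗ₜ[k] b = ((1 : A) ⊗ₜ[k] b) * lft k (n * a) by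
              simp [Algebra.TensorProduct.tmul_mul_tmul], mul_smul, h1, smul_zero] }
  have hN : N ≠ ⊥ := by
    let _ : Module A Q := Module.compHom Q
      (Algebra.TensorProduct.includeLeft (R := k) (S := k) (A := A) (B := Aᵐᵒᵖ)).toRingHom
    have hsm : ∀ (a : A) (q : Q), a • q = lft k a • q := fun a q => rfl
    have : IsScalarTower k A Q := ⟨fun c a q => by
      rw [hsm, hsm, ← smul_assoc, TensorProduct.smul_tmul']⟩
    have : Module.Finite A Q := Module.Finite.of_restrictScalars_finite k A Q
    have : IsArtinianRing A := IsArtinianRing.of_finite k A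
    have : IsArtinian A Q := inferInstance
    have : Nontrivial Q := IsSimpleModule.nontrivial (A ⊗[k] Aᵐᵒᵖ) Q
    obtain ⟨U, hU⟩ := IsAtomic.exists_atom (Submodule A Q)
    have hU' : IsSimpleModule A U := isSimpleModule_iff_isAtom.2 hU
    obtain ⟨w, hw, hw0⟩ := U.ne_bot_iff.1 hU.1
    intro hb
    have : w ∈ N := by
      intro n hn
      have h1 := IsSemisimpleModule.jacobson_le_annihilator A U hn
      have h2 := Module.mem_annihilator.1 h1 ⟨w, hw⟩
      rw [← hsm]
      simpa using congrArg Subtype.val h2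
    rw [hb] at this
    exact hw0 this
  have hN' : N = ⊤ := (eq_bot_or_eq_top N).resolve_left hN
  have : q ∈ N := hN' ▸ Submodule.mem_top
  exact this n hn

variable {S S' : Type v} [AddCommGroup S] [Module k S] [Module A S] [IsScalarTower k A S]
  [AddCommGroup S'] [Module k S'] [Module A S'] [IsScalarTower k A S']
  {e e' : A} {s : S} {s' : S'} {l : Module.Dual k S} {l' : Module.Dual k S'}

lemma left_scalar [IsSimpleModule (A ⊗[k] Aᵐᵒᵖ) Q]
    (h : PrimData k A S e s l) (v : Q) (hv : lft k e • v = v) (a : A) :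
    lft k (e * a * e) • v = l (a • s) • v := by
  have h1 := jac_left (k := k) (h.sub_mem a) v
  rw [lft, TensorProduct.sub_tmul, sub_smul, sub_eq_zero, ← TensorProduct.smul_tmul',
    smul_assoc, hv] at h1
  exact h1

lemma rgt_scalar_smul (c : k) (a : A) (v : Q) : rgt k (c • a) • v = c • rgt k a • v := by
  rw [rgt, MulOpposite.op_smul, TensorProduct.tmul_smul, smul_assoc]

lemma rgt_zero_smul (v : Q) : rgt k (0 : A) • v = 0 := by
  have h : rgt k (0 : A) = 0 := TensorProduct.tmul_zero _ _
  rw [h]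
  exact zero_smul (A ⊗[k] Aᵐᵒᵖ) v

lemma jac_right [IsSimpleModule (A ⊗[k] Aᵐᵒᵖ) Q]
    (h : PrimData k A S e s l) (v : Q)
    (hv : lft k e • v = v) {n : A} (hn : n ∈ Ring.jacobson A) :
    rgt k n • v = 0 := by
  by_contra hne
  obtain ⟨x, hx⟩ := IsSimpleModule.toSpanSingleton_surjective (A ⊗[k] Aᵐᵒᵖ) hne v
  simp only [LinearMap.toSpanSingleton_apply] at hx
  have key : ∀ x : A ⊗[k] Aᵐᵒᵖ, ∃ m ∈ Ring.jacobson A,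
      lft k e • x • rgt k n • v = rgt k m • v := by
    intro x
    induction x with
    | zero => exact ⟨0, zero_mem _, (congrArg (lft k e • ·) (zero_smul (A ⊗[k] Aᵐᵒᵖ) _)).trans
        ((smul_zero _).trans (rgt_zero_smul v).symm)⟩
    | add x y hx hy =>
      obtain ⟨m, hm, h1⟩ := hx
      obtain ⟨m', hm', h2⟩ := hy
      exact ⟨m + m', add_mem hm hm', by
        rw [add_smul, smul_add, h1, h2, rgt, rgt, rgt, MulOpposite.op_add,
          TensorProduct.tmul_add, add_smul]⟩
    | tmul a b =>
      refine ⟨l (a • s) • (n * b.unop),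
        Submodule.smul_of_tower_mem _ _ (Ideal.mul_mem_right _ _ hn), ?_⟩
      rw [rgt_scalar_smul]
      have : lft k e * (a ⊗ₜ[k] b) * rgt k n * lft k e = rgt k (n * b.unop) * lft k (e * a * e) := by
        simp [Algebra.TensorProduct.tmul_mul_tmul]
      calc _ = (lft k e * (a ⊗ₜ[k] b) * rgt k n * lft k e) • v := by
            rw [mul_smul, mul_smul, mul_smul, hv]
        _ = _ := by rw [this, mul_smul, left_scalar h v hv, smul_algebra_smul_comm]
  obtain ⟨m, hm, h1⟩ := key x
  rw [hx, hv] at h1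
  obtain ⟨N, hN⟩ := nilp_of_mem (k := k) hm
  have h2 : ∀ N : ℕ, rgt k (m ^ N) • v = v := by
    intro N
    induction N with
    | zero => rw [pow_zero, rgt, MulOpposite.op_one, ← Algebra.TensorProduct.one_def, one_smul]
    | succ N ih =>
      rw [show rgt k (m ^ (N + 1)) = rgt k m * rgt k (m ^ N) by
        rw [Algebra.TensorProduct.tmul_mul_tmul, pow_succ, one_mul, rgt, MulOpposite.op_mul], mul_smul, ih, ← h1]
  have h3 := h2 N
  rw [hN, rgt_zero_smul] at h3
  rw [← h3, smul_zero] at hne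
  exact hne rfl

lemma right_scalar [IsSimpleModule (A ⊗[k] Aᵐᵒᵖ) Q]
    (h : PrimData k A S e s l) (h' : PrimData k A S' e' s' l') (v : Q)
    (hv : lft k e • v = v) (hv' : rgt k e' • v = v) (b : A) :
    rgt k (e' * b * e') • v = l' (b • s') • v := by
  have h1 := jac_right (k := k) h v hv (h'.sub_mem b)
  rw [rgt, MulOpposite.op_sub, TensorProduct.tmul_sub, sub_smul, sub_eq_zero] at h1
  have h2 := rgt_scalar_smul (l' (b • s')) e' v
  rw [hv'] at h2
  rw [← h2]
  exact h1

lemma Q_scalar [IsSimpleModule (A ⊗[k] Aᵐᵒᵖ) Q]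
    (h : PrimData k A S e s l) (h' : PrimData k A S' e' s' l') (v : Q)
    (hv : (e ⊗ₜ[k] MulOpposite.op e' : A ⊗[k] Aᵐᵒᵖ) • v = v) (a b : A) :
    ((e ⊗ₜ[k] MulOpposite.op e' : A ⊗[k] Aᵐᵒᵖ) * (a ⊗ₜ[k] MulOpposite.op b)) • v =
      (l (a • s) * l' (b • s')) • v := by
  have hvl : lft k e • v = v := by
    rw [← hv, ← mul_smul, Algebra.TensorProduct.tmul_mul_tmul, h.idem, one_mul]
  have hvr : rgt k e' • v = v := by
    rw [← hv, ← mul_smul, Algebra.TensorProduct.tmul_mul_tmul, one_mul, ← MulOpposite.op_mul,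
      h'.idem]
  have : (e ⊗ₜ[k] MulOpposite.op e' : A ⊗[k] Aᵐᵒᵖ) * (a ⊗ₜ[k] MulOpposite.op b) *
      (e ⊗ₜ[k] MulOpposite.op e') = lft k (e * a * e) * rgt k (e' * b * e') := by
    simp [Algebra.TensorProduct.tmul_mul_tmul, mul_assoc]
  conv_lhs => rw [← hv, ← mul_smul, this, mul_smul, right_scalar h h' v hvl hvr,
    smul_algebra_smul_comm, left_scalar h v hvl, ← mul_smul, mul_comm]

end bimod

section T

variable {k : Type u} [Field k] {A : Type v} [Ring A] [Algebra k A]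
  {S S' : Type v} [AddCommGroup S] [Module k S] [Module A S] [IsScalarTower k A S]
  [AddCommGroup S'] [Module k S'] [Module A S'] [IsScalarTower k A S'] [FiniteDimensional k S']
  {e e' : A} {s : S} {s' : S'} {l : Module.Dual k S} {l' : Module.Dual k S'}
  [Module Aᵐᵒᵖ (Module.Dual k S')]
  [Module (A ⊗[k] Aᵐᵒᵖ) (S ⊗[k] Module.Dual k S')]

/-- contraction -/
noncomputable def ctr (k : Type u) [Field k] (S S' : Type v) [AddCommGroup S] [Module k S]
    [AddCommGroup S'] [Module k S'] : S ⊗[k] Module.Dual k S' →ₗ[k] (S' →ₗ[k] S) :=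
  (dualTensorHom k S' S).comp (TensorProduct.comm k S (Module.Dual k S')).toLinearMap

lemma ctr_tmul (x : S) (φ : Module.Dual k S') (y : S') : ctr k S S' (x ⊗ₜ φ) y = φ y • x := by
  simp [ctr]

lemma ctr_smul (c : k) (x : S ⊗[k] Module.Dual k S') (y : S') :
    ctr k S S' (c • x) y = c • ctr k S S' x y := by
  rw [map_smul, LinearMap.smul_apply]

lemma ctr_inj : Function.Injective (ctr k S S') :=
  (dualTensorHom_bijective (R := k) (M := S') (N := S)).1.comp (TensorProduct.comm k S (Module.Dual k S')).injective

variable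
    (hdual : ∀ (a : A) (φ : Module.Dual k S') (s : S'), (MulOpposite.op a • φ) s = φ (a • s))
    (hact : ∀ (a b : A) (s : S) (φ : Module.Dual k S'),
      (a ⊗ₜ[k] (MulOpposite.op b) : A ⊗[k] Aᵐᵒᵖ) • (s ⊗ₜ[k] φ : S ⊗[k] Module.Dual k S')
        = (a • s) ⊗ₜ[k] (MulOpposite.op b • φ))

include hdual hact

lemma ctr_act (a b : A) (x : S ⊗[k] Module.Dual k S') (y : S') :
    ctr k S S' ((a ⊗ₜ[k] (MulOpposite.op b) : A ⊗[k] Aᵐᵒᵖ) • x) y =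
      a • ctr k S S' x (b • y) := by
  induction x with
  | zero => simp
  | add x y hx hy => simp only [smul_add, map_add, LinearMap.add_apply, hx, hy]
  | tmul x φ => rw [hact, ctr_tmul, ctr_tmul, hdual, smul_comm]

lemma T_tower : IsScalarTower k (A ⊗[k] Aᵐᵒᵖ) (S ⊗[k] Module.Dual k S') := by
  refine ⟨fun c x y => ?_⟩
  have h0 : ∀ z : S ⊗[k] Module.Dual k S', (0 : A ⊗[k] Aᵐᵒᵖ) • z = 0 := fun z =>
    zero_smul (A ⊗[k] Aᵐᵒᵖ) z
  induction x with
  | zero => 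
    rw [smul_zero]
    exact (h0 y).trans (by rw [h0 y, smul_zero])
  | add x x' hx hx' => rw [smul_add, add_smul, hx, hx', add_smul, smul_add]
  | tmul a b =>
    apply ctr_inj
    ext w
    rw [TensorProduct.smul_tmul', ← MulOpposite.op_unop b, ctr_act hdual hact, ctr_smul, ctr_act hdual hact, smul_assoc]

variable (h : PrimData k A S e s l) (h' : PrimData k A S' e' s' l')
include h h'

lemma T_scalar (a b : A) :
    ((e ⊗ₜ[k] MulOpposite.op e' : A ⊗[k] Aᵐᵒᵖ) * (a ⊗ₜ[k] MulOpposite.op b)) •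
        (s ⊗ₜ[k] l' : S ⊗[k] Module.Dual k S') =
      (l (a • s) * l' (b • s')) • (s ⊗ₜ[k] l' : S ⊗[k] Module.Dual k S') := by
  apply ctr_inj
  ext w
  rw [mul_smul, ctr_act hdual hact, ctr_act hdual hact, ctr_smul, ctr_tmul, ctr_tmul,
    h'.ey, smul_comm b, map_smul l', smul_comm a, smul_comm e, h.ey, smul_eq_mul, ← mul_smul,
    ← mul_smul]
  congr 1; ring

lemma T_eps (x : S ⊗[k] Module.Dual k S') :
    (e ⊗ₜ[k] MulOpposite.op e' : A ⊗[k] Aᵐᵒᵖ) • x =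
      (l (ctr k S S' x s')) • (s ⊗ₜ[k] l' : S ⊗[k] Module.Dual k S') := by
  apply ctr_inj
  ext w
  rw [ctr_act hdual hact, ctr_smul, ctr_tmul,
    h'.ey, map_smul _ (l' w), smul_comm e, h.ey, smul_comm]

lemma T_ne : (s ⊗ₜ[k] l' : S ⊗[k] Module.Dual k S') ≠ 0 := by
  intro h0
  have := congrArg l (LinearMap.congr_fun (congrArg (ctr k S S') h0) s')
  rw [ctr_tmul, h'.ls, one_smul, h.ls] at this
  simp at this

lemma T_simple [IsSimpleModule A S] [IsSimpleModule A S'] :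
    IsSimpleModule (A ⊗[k] Aᵐᵒᵖ) (S ⊗[k] Module.Dual k S') := by
  have ht := T_ne hdual hact h h'
  have hs : s ≠ 0 := by
    rintro rfl
    simpa using h.ls
  have hT := T_tower hdual hact
  have hdualgen : ∀ φ : Module.Dual k S', ∃ b : A, φ = MulOpposite.op b • l' := by
    let p : Submodule k (Module.Dual k S') :=
      { carrier := {φ | ∃ b : A, φ = MulOpposite.op b • l'}
        add_mem' := by
          rintro _ _ ⟨b, rfl⟩ ⟨c, rfl⟩
          exact ⟨b + c, by rw [MulOpposite.op_add, add_smul]⟩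
        zero_mem' := ⟨0, by rw [MulOpposite.op_zero, zero_smul]⟩
        smul_mem' := by
          rintro c _ ⟨b, rfl⟩
          refine ⟨c • b, ?_⟩
          ext w
          rw [LinearMap.smul_apply, hdual, hdual, smul_assoc, map_smul l' c] }
    have hp : p = ⊤ := by
      by_contra hne
      obtain ⟨F, hF, hpF⟩ := Submodule.exists_le_ker_of_lt_top p (lt_top_iff_ne_top.2 hne)
      obtain ⟨w, rfl⟩ := (Module.evalEquiv k S').surjective F
      have hw : w ≠ 0 := by
        rintro rfl
        simp at hF
      obtain ⟨b, hb⟩ := IsSimpleModule.toSpanSingleton_surjective A hw s'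
      have h1 : MulOpposite.op b • l' ∈ p := ⟨b, rfl⟩
      have h2 := hpF h1
      rw [LinearMap.mem_ker, Module.evalEquiv_apply, Module.Dual.eval_apply, hdual] at h2
      simp only [LinearMap.toSpanSingleton_apply] at hb
      rw [hb, h'.ls] at h2
      exact one_ne_zero h2
    intro φ
    have : φ ∈ p := hp ▸ Submodule.mem_top
    exact this
  rw [isSimpleModule_iff_toSpanSingleton_surjective]
  refine ⟨⟨_, _, ht⟩, fun x hx => ?_⟩
  have hgen : ∃ z : A ⊗[k] Aᵐᵒᵖ, z • x = s ⊗ₜ[k] l' := by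
    obtain ⟨w, hw⟩ : ∃ w, ctr k S S' x w ≠ 0 := by
      by_contra hcon
      push Not at hcon
      apply hx
      apply ctr_inj
      ext w
      rw [hcon w]; simp
    have hs' : s' ≠ 0 := by
      rintro rfl
      simpa using h'.ls
    obtain ⟨b, hb⟩ := IsSimpleModule.toSpanSingleton_surjective A hs' w
    obtain ⟨a, ha⟩ := IsSimpleModule.toSpanSingleton_surjective A hw s
    simp only [LinearMap.toSpanSingleton_apply] at hb ha
    refine ⟨a ⊗ₜ[k] MulOpposite.op (b * e'), ?_⟩
    apply ctr_inj
    ext y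
    rw [ctr_act hdual hact, ctr_tmul, mul_smul, h'.ey, smul_comm b, map_smul _ (l' y), hb, smul_comm a, ha]
  obtain ⟨z, hz⟩ := hgen
  rw [← LinearMap.range_eq_top, eq_top_iff]
  rintro y -
  induction y with
  | zero => exact zero_mem _
  | add y y' hy hy' => exact add_mem hy hy'
  | tmul y φ =>
    obtain ⟨b, rfl⟩ := hdualgen φ
    obtain ⟨a, ha⟩ := IsSimpleModule.toSpanSingleton_surjective A hs y
    simp only [LinearMap.toSpanSingleton_apply] at ha
    refine ⟨(a ⊗ₜ[k] MulOpposite.op b) * z, ?_⟩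
    rw [LinearMap.toSpanSingleton_apply, mul_smul, hz, hact, ha]

lemma exists_iso [FiniteDimensional k A] [IsSimpleModule A S] [IsSimpleModule A S']
    {Q : Type*} [AddCommGroup Q] [Module (A ⊗[k] Aᵐᵒᵖ) Q] [Module k Q]
    [IsScalarTower k (A ⊗[k] Aᵐᵒᵖ) Q] [FiniteDimensional k Q] [IsSimpleModule (A ⊗[k] Aᵐᵒᵖ) Q]
    (q : Q) (hq : (e ⊗ₜ[k] MulOpposite.op e' : A ⊗[k] Aᵐᵒᵖ) • q ≠ 0) :
    Nonempty (Q ≃ₗ[A ⊗[k] Aᵐᵒᵖ] (S ⊗[k] Module.Dual k S')) := by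
  have := T_simple hdual hact h h'
  have hid : (e ⊗ₜ[k] MulOpposite.op e' : A ⊗[k] Aᵐᵒᵖ) * (e ⊗ₜ[k] MulOpposite.op e') =
      e ⊗ₜ[k] MulOpposite.op e' := by
    rw [Algebra.TensorProduct.tmul_mul_tmul, h.idem, ← MulOpposite.op_mul, h'.idem]
  have hv : (e ⊗ₜ[k] MulOpposite.op e' : A ⊗[k] Aᵐᵒᵖ) •
      (e ⊗ₜ[k] MulOpposite.op e' : A ⊗[k] Aᵐᵒᵖ) • q =
      (e ⊗ₜ[k] MulOpposite.op e' : A ⊗[k] Aᵐᵒᵖ) • q := by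
    rw [← mul_smul, hid]
  refine iso_of_scalar (k := k) (e ⊗ₜ[k] MulOpposite.op e' : A ⊗[k] Aᵐᵒᵖ) (s ⊗ₜ[k] l') _
    (T_ne hdual hact h h') hq ?_ hv ?_
  · rw [T_eps hdual hact h h', ctr_tmul, h'.ls, one_smul, h.ls, one_smul]
  · intro x
    induction x with
    | zero =>
      refine ⟨0, ?_, ?_⟩
      · rw [zero_smul]
        have h0 : (e ⊗ₜ[k] MulOpposite.op e' : A ⊗[k] Aᵐᵒᵖ) * 0 = 0 := mul_zero _
        exact (congrArg (fun z : A ⊗[k] Aᵐᵒᵖ => z • (s ⊗ₜ[k] l' : S ⊗[k] Module.Dual k S')) h0).trans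
          (zero_smul (A ⊗[k] Aᵐᵒᵖ) (s ⊗ₜ[k] l' : S ⊗[k] Module.Dual k S'))
      · rw [zero_smul]
        have h0 : (e ⊗ₜ[k] MulOpposite.op e' : A ⊗[k] Aᵐᵒᵖ) * 0 = 0 := mul_zero _
        generalize (e ⊗ₜ[k] MulOpposite.op e' : A ⊗[k] Aᵐᵒᵖ) • q = w
        exact (congrArg (fun z : A ⊗[k] Aᵐᵒᵖ => z • w) h0).trans
          (zero_smul (A ⊗[k] Aᵐᵒᵖ) w)
    | add x y hx hy =>
      obtain ⟨c, h1, h2⟩ := hx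
      obtain ⟨d, h3, h4⟩ := hy
      exact ⟨c + d, by rw [mul_add, add_smul, h1, h3, add_smul],
        by rw [mul_add, add_smul, h2, h4, add_smul]⟩
    | tmul a b =>
      exact ⟨l (a • s) * l' (b.unop • s'), T_scalar hdual hact h h' a b.unop,
        Q_scalar h h' _ hv a b.unop⟩

end T

section count

variable {k : Type u} [Field k] {E : Type*} [Ring E] [Algebra k E]
  {M : Type*} [AddCommGroup M] [Module E M] [Module k M] [IsScalarTower k E M]
  [FiniteDimensional k M]

lemma rank_step (ε : E) (hε : ε * ε = ε) (N N' : Submodule E M) (hN : N ≤ N') :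
    Module.finrank k ((N'.restrictScalars k).map (Algebra.lsmul k k M ε)) =
    Module.finrank k ((N.restrictScalars k).map (Algebra.lsmul k k M ε)) +
    Module.finrank k (LinearMap.range
      (Algebra.lsmul k k (↥N' ⧸ Submodule.comap N'.subtype N) ε)) := by
  let W' := (N'.restrictScalars k).map (Algebra.lsmul k k M ε)
  let W := (N.restrictScalars k).map (Algebra.lsmul k k M ε)
  have hW : ∀ w : W', (w : M) ∈ N' := by
    rintro ⟨_, ⟨x, hx, rfl⟩⟩
    exact N'.smul_mem ε hx
  have hWW : W ≤ W' := Submodule.map_mono (fun x hx => hN hx)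
  let i : W' →ₗ[k] N' :=
    { toFun := fun w => ⟨w, hW w⟩
      map_add' := fun _ _ => rfl
      map_smul' := fun _ _ => rfl }
  let h : W' →ₗ[k] (↥N' ⧸ Submodule.comap N'.subtype N) :=
    ((Submodule.comap N'.subtype N).mkQ.restrictScalars k).comp i
  have hh : ∀ w, h w = Submodule.Quotient.mk ⟨w, hW w⟩ := fun w => rfl
  have h1 := LinearMap.finrank_range_add_finrank_ker h
  have h2 : LinearMap.range h = LinearMap.range
      (Algebra.lsmul k k (↥N' ⧸ Submodule.comap N'.subtype N) ε) := by
    ext q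
    constructor
    · rintro ⟨⟨_, ⟨x, hx, rfl⟩⟩, rfl⟩
      exact ⟨Submodule.Quotient.mk ⟨x, hx⟩, rfl⟩
    · rintro ⟨q, rfl⟩
      obtain ⟨⟨x, hx⟩, rfl⟩ := Submodule.Quotient.mk_surjective _ q
      exact ⟨⟨ε • x, ⟨x, hx, rfl⟩⟩, rfl⟩
  have h3 : LinearMap.ker h = W.comap W'.subtype := by
    ext ⟨_, ⟨x, hx, rfl⟩⟩
    rw [LinearMap.mem_ker, hh, Submodule.Quotient.mk_eq_zero]
    simp only [Submodule.mem_comap, Submodule.subtype_apply]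
    constructor
    · intro hy
      refine ⟨_, hy, ?_⟩
      simp [← mul_smul, hε]
    · rintro ⟨y, hy, hyx⟩
      rw [← hyx]
      exact N.smul_mem ε hy
  rw [h2, h3, LinearEquiv.finrank_eq (Submodule.comapSubtypeEquivOfLe hWW)] at h1
  rw [add_comm]
  exact h1.symm

lemma tele (n : ℕ) (g : Fin (n + 1) → ℕ) (d : Fin n → ℕ)
    (hg : ∀ i : Fin n, g i.succ = g i.castSucc + d i) : g (Fin.last n) = g 0 + ∑ i, d i := by
  induction n with
  | zero => simp
  | succ n ih =>
    rw [Fin.sum_univ_castSucc, ← add_assoc, ← Fin.succ_last, hg]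
    congr 1
    exact ih (fun i => g i.castSucc) (fun i => d i.castSucc) (fun i => hg i.castSucc)

lemma rank_iso (ε : E) {Q T : Type*} [AddCommGroup Q] [Module E Q] [Module k Q]
    [IsScalarTower k E Q] [AddCommGroup T] [Module E T] [Module k T] [IsScalarTower k E T]
    (h : Nonempty (Q ≃ₗ[E] T)) :
    Module.finrank k (LinearMap.range (Algebra.lsmul k k Q ε)) =
    Module.finrank k (LinearMap.range (Algebra.lsmul k k T ε)) := by
  obtain ⟨φ⟩ := h
  have hmap : (LinearMap.range (Algebra.lsmul k k Q ε)).map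
      (φ.restrictScalars k).toLinearMap = LinearMap.range (Algebra.lsmul k k T ε) := by
    ext y
    constructor
    · rintro ⟨_, ⟨x, rfl⟩, rfl⟩
      exact ⟨φ x, (map_smul φ ε x).symm⟩
    · rintro ⟨x, rfl⟩
      refine ⟨_, ⟨φ.symm x, rfl⟩, ?_⟩
      exact (map_smul φ ε (φ.symm x)).trans (by simp)
  rw [← hmap]
  exact (LinearEquiv.finrank_map_eq (φ.restrictScalars k) _).symm

lemma rank_zero (ε : E) {Q : Type*} [AddCommGroup Q] [Module E Q] [Module k Q]
    [IsScalarTower k E Q] (h : ∀ q : Q, ε • q = 0) :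
    Module.finrank k (LinearMap.range (Algebra.lsmul k k Q ε)) = 0 := by
  have : LinearMap.range (Algebra.lsmul k k Q ε) = ⊥ := by
    rw [LinearMap.range_eq_bot]
    ext q
    exact h q
  rw [this, finrank_bot]

lemma fd_quot_aux {V : Type*} [AddCommGroup V] [Module E V] [Module k V] [IsScalarTower k E V]
    [FiniteDimensional k V] (K : Submodule E V) : FiniteDimensional k (V ⧸ K) :=
  Module.Finite.of_surjective (K.mkQ.restrictScalars k) K.mkQ_surjective

lemma fd_sub (N : Submodule E M) : FiniteDimensional k N :=
  Module.Finite.of_injective (N.subtype.restrictScalars k) N.subtype_injective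

lemma fd_quot (N N' : Submodule E M) :
    FiniteDimensional k (↥N' ⧸ Submodule.comap N'.subtype N) := by
  have : FiniteDimensional k N' := fd_sub N'
  exact fd_quot_aux _

lemma count (ε : E) (hε : ε * ε = ε) (cs : CompositionSeries (Submodule E M))
    (hbot : cs.head = ⊥) (htop : cs.last = ⊤)
    (T : Type*) [AddCommGroup T] [Module E T] [Module k T] [IsScalarTower k E T]
    (hT : Module.finrank k (LinearMap.range (Algebra.lsmul k k T ε)) = 1)
    (hiso : ∀ N N' : Submodule E M, IsSimpleModule E (↥N' ⧸ Submodule.comap N'.subtype N) →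
      FiniteDimensional k (↥N' ⧸ Submodule.comap N'.subtype N) → ∀ q : (↥N' ⧸ Submodule.comap N'.subtype N), ε • q ≠ 0 →
      Nonempty ((↥N' ⧸ Submodule.comap N'.subtype N) ≃ₗ[E] T)) :
    compMult cs T = Module.finrank k (LinearMap.range (Algebra.lsmul k k M ε)) := by
  classical
  let g : Fin (cs.length + 1) → ℕ := fun i =>
    Module.finrank k (((cs i).restrictScalars k).map (Algebra.lsmul k k M ε))
  let d : Fin cs.length → ℕ := fun i => Module.finrank k (LinearMap.range
      (Algebra.lsmul k k (↥(cs i.succ) ⧸ Submodule.comap (cs i.succ).subtype (cs i.castSucc)) ε))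
  have hcov : ∀ i : Fin cs.length, cs i.castSucc ⋖ cs i.succ := fun i => cs.step i
  have h1 := tele cs.length g d (fun i => rank_step ε hε _ _ (hcov i).le)
  have h2 : g 0 = 0 := by
    have : cs 0 = ⊥ := hbot
    simp only [g]
    rw [this, Submodule.restrictScalars_bot, Submodule.map_bot, finrank_bot]
  have h3 : g (Fin.last _) = Module.finrank k (LinearMap.range (Algebra.lsmul k k M ε)) := by
    have : cs (Fin.last _) = ⊤ := htop
    simp only [g]
    rw [this, Submodule.restrictScalars_top, Submodule.map_top]
  have h4 : ∀ i, d i = if Nonempty ((↥(cs i.succ) ⧸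
      Submodule.comap (cs i.succ).subtype (cs i.castSucc)) ≃ₗ[E] T) then 1 else 0 := by
    intro i
    split_ifs with hi
    · exact (rank_iso ε hi).trans hT
    · have hs : IsSimpleModule E (↥(cs i.succ) ⧸
          Submodule.comap (cs i.succ).subtype (cs i.castSucc)) :=
        (covBy_iff_quot_is_simple (hcov i).le).1 (hcov i)
      refine rank_zero ε fun q => ?_
      by_contra hne
      exact hi (hiso _ _ hs (fd_quot _ _) q hne)
  rw [← h3, h1, h2, zero_add, Finset.sum_congr rfl (fun i _ => h4 i), Finset.sum_boole,
    compMult, Nat.card_eq_fintype_card, Fintype.card_subtype]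
  rfl

end count

section hom

variable {k : Type u} [Field k] {A : Type v} [Ring A] [Algebra k A]
  {P P' : Type v} [AddCommGroup P] [Module k P] [Module A P] [IsScalarTower k A P]
  [AddCommGroup P'] [Module k P'] [Module A P'] [IsScalarTower k A P']

lemma hom_rank (p : P) (σ : P →ₗ[A] A) (hσ : ∀ x, σ x • p = x)
    (p' : P') (σ' : P' →ₗ[A] A) (hσ' : ∀ x, σ' x • p' = x) (L : A →ₗ[k] A)
    (hL : ∀ x, L x = σ p * x * σ' p') :
    Module.finrank k (P →ₗ[A] P') = Module.finrank k (LinearMap.range L) := by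
  let F : (P →ₗ[A] P') →ₗ[k] A :=
    { toFun := fun φ => σ' (φ p)
      map_add' := fun φ ψ => by simp
      map_smul' := fun c φ => by
        rw [LinearMap.smul_apply, ← algebraMap_smul A c, map_smul, algebraMap_smul]; rfl }
  have hF : ∀ φ, F φ = σ' (φ p) := fun φ => rfl
  have hinj : Function.Injective F := by
    intro φ ψ h
    rw [hF, hF] at h
    have h1 : φ p = ψ p := by rw [← hσ' (φ p), h, hσ']
    ext x
    rw [← hσ x, map_smul, map_smul, h1]
  have hr : LinearMap.range F = LinearMap.range L := by
    ext y
    constructor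
    · rintro ⟨φ, rfl⟩
      refine ⟨F φ, ?_⟩
      rw [hL, hF, ← smul_eq_mul (σ p), ← map_smul, ← map_smul, hσ, ← smul_eq_mul, ← map_smul, hσ']
    · rintro ⟨x, rfl⟩
      refine ⟨(LinearMap.toSpanSingleton A P' (x • p')).comp σ, ?_⟩
      rw [hF, hL, LinearMap.comp_apply, LinearMap.toSpanSingleton_apply, ← mul_smul, map_smul,
        smul_eq_mul]
  rw [← hr, LinearMap.finrank_range_of_inj hinj]

end hom

end BimodCartan

/-- Let `k` be an algebraically closed field of characteristic zero and `A` a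
finite-dimensional `k`-algebra, with `(S i)` a complete set of representatives of the simple
left `A`-modules and `P i` a projective cover of `S i`.  Regard `A` as a left
`A ⊗[k] Aᵐᵒᵖ`-module via `(a ⊗ b) • x = a * x * b`.  Then for all `i, j`, the composition
multiplicity of the simple `A ⊗[k] Aᵐᵒᵖ`-module `S i ⊗[k] (S j)^*` in `A` equals the Cartan
matrix entry `c i j = dim_k Hom_A(P i, P j)`, where `(S j)^* = Hom_k(S j, k)` is the dual
right `A`-module (a left `Aᵐᵒᵖ`-module) with action `(f · a) s = f (a • s)`. -/
theorem multiplicity_in_regular_bimodule_eq_cartan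
    (k : Type u) [Field k] [IsAlgClosed k] [CharZero k]
    (A : Type v) [Ring A] [Algebra k A] [FiniteDimensional k A]
    (I : Type v) [Fintype I]
    (S : I → Type v) [∀ i, AddCommGroup (S i)] [∀ i, Module k (S i)] [∀ i, Module A (S i)]
    [∀ i, IsScalarTower k A (S i)] [∀ i, FiniteDimensional k (S i)]
    (hsimple : ∀ i, IsSimpleModule A (S i))
    (hdistinct : ∀ i i', Nonempty (S i ≃ₗ[A] S i') → i = i')
    (hcomplete : ∀ (U : Type v) [AddCommGroup U] [Module A U],
      IsSimpleModule A U → ∃ i, Nonempty (U ≃ₗ[A] S i))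
    (P : I → Type v) [∀ i, AddCommGroup (P i)] [∀ i, Module k (P i)] [∀ i, Module A (P i)]
    [∀ i, IsScalarTower k A (P i)] [∀ i, FiniteDimensional k (P i)]
    (hproj : ∀ i, Module.Projective A (P i))
    (f : ∀ i, P i →ₗ[A] S i) (hsurj : ∀ i, Function.Surjective (f i))
    (hsmall : ∀ i, ∀ K : Submodule A (P i), LinearMap.ker (f i) ⊔ K = ⊤ → K = ⊤)
    -- `A` as a left module over the enveloping algebra `A ⊗[k] Aᵐᵒᵖ`, via `(a ⊗ b) • x = a x b`
    [Module (A ⊗[k] Aᵐᵒᵖ) A]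
    (hbimod : ∀ (a b x : A),
      (a ⊗ₜ[k] (MulOpposite.op b) : A ⊗[k] Aᵐᵒᵖ) • x = a * x * b)
    -- the duals `(S j)^*` as left `Aᵐᵒᵖ`-modules, via `(f · a) s = f (a • s)`
    [∀ j, Module Aᵐᵒᵖ (Module.Dual k (S j))]
    (hdual : ∀ (j : I) (a : A) (φ : Module.Dual k (S j)) (s : S j),
      (MulOpposite.op a • φ) s = φ (a • s))
    -- the `A ⊗[k] Aᵐᵒᵖ`-modules `S i ⊗[k] (S j)^*`
    [∀ i j, Module (A ⊗[k] Aᵐᵒᵖ) (S i ⊗[k] Module.Dual k (S j))]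
    (hact : ∀ (i j : I) (a b : A) (s : S i) (φ : Module.Dual k (S j)),
      (a ⊗ₜ[k] (MulOpposite.op b) : A ⊗[k] Aᵐᵒᵖ)
          • (s ⊗ₜ[k] φ : S i ⊗[k] Module.Dual k (S j))
        = (a • s) ⊗ₜ[k] (MulOpposite.op b • φ))
    (cs : CompositionSeries (Submodule (A ⊗[k] Aᵐᵒᵖ) A))
    (hbot : cs.head = ⊥) (htop : cs.last = ⊤)
    (i j : I) :
    compMult cs (S i ⊗[k] Module.Dual k (S j)) = Module.finrank k (P i →ₗ[A] P j) := by
  have := hsimple i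
  have := hsimple j
  obtain ⟨p, σ, s, l, hσ, hd⟩ := BimodCartan.exists_data (k := k) (S i) (P i) (hsimple i) (hproj i)
    (f i) (hsurj i) (hsmall i)
  obtain ⟨p', σ', s', l', hσ', hd'⟩ := BimodCartan.exists_data (k := k) (S j) (P j) (hsimple j)
    (hproj j) (f j) (hsurj j) (hsmall j)
  have hT : IsScalarTower k (A ⊗[k] Aᵐᵒᵖ) (S i ⊗[k] Module.Dual k (S j)) :=
    BimodCartan.T_tower (hdual j) (hact i j)
  have hM : IsScalarTower k (A ⊗[k] Aᵐᵒᵖ) A := by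
    refine IsScalarTower.of_algebraMap_smul (R := k) (A := A ⊗[k] Aᵐᵒᵖ) (M := A) fun c x => ?_
    rw [Algebra.TensorProduct.algebraMap_apply, ← MulOpposite.op_one, hbimod, mul_one,
      Algebra.smul_def]
  have hid : (σ p ⊗ₜ[k] MulOpposite.op (σ' p') : A ⊗[k] Aᵐᵒᵖ) *
      (σ p ⊗ₜ[k] MulOpposite.op (σ' p')) = σ p ⊗ₜ[k] MulOpposite.op (σ' p') := by
    rw [Algebra.TensorProduct.tmul_mul_tmul, hd.idem, ← MulOpposite.op_mul, hd'.idem]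
  rw [BimodCartan.hom_rank (k := k) p σ hσ p' σ' hσ'
    (Algebra.lsmul k k A (σ p ⊗ₜ[k] MulOpposite.op (σ' p') : A ⊗[k] Aᵐᵒᵖ))
    (fun x => hbimod _ _ x)]
  refine BimodCartan.count _ hid cs hbot htop _ ?_ ?_
  · have hr : LinearMap.range (Algebra.lsmul k k (S i ⊗[k] Module.Dual k (S j))
        (σ p ⊗ₜ[k] MulOpposite.op (σ' p') : A ⊗[k] Aᵐᵒᵖ)) =
        Submodule.span k {s ⊗ₜ[k] l'} := by
      ext y
      rw [Submodule.mem_span_singleton]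
      constructor
      · rintro ⟨x, rfl⟩
        exact ⟨_, (BimodCartan.T_eps (hdual j) (hact i j) hd hd' x).symm⟩
      · rintro ⟨c, rfl⟩
        refine ⟨c • s ⊗ₜ[k] l', ?_⟩
        rw [map_smul]
        congr 1
        refine (BimodCartan.T_eps (hdual j) (hact i j) hd hd' _).trans ?_
        rw [BimodCartan.ctr_tmul, hd'.ls, one_smul, hd.ls, one_smul]
    rw [hr]
    exact finrank_span_singleton (BimodCartan.T_ne (hdual j) (hact i j) hd hd')
  · intro N N' hs hfd q hq
    exact BimodCartan.exists_iso (hdual j) (hact i j) hd hd' q hq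
end
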